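/- Let β ∈ (1/3, 2/3), let p be a positive integer, and let A₁, A₂ ∈ Skew(p) and B₁, B₂ ∈ ℝ^{1×p} (row vectors) satisfy β‖A_i‖_F² + ‖B_i‖_F² = 1 for i = 1,2 and β·tr(A₁ᵀA₂) + tr(B₁ᵀB₂) = 0. Then the quantity 𝒦_β(Δ₁,Δ₂) = (1/2)‖B₁B₂ᵀ − B₂B₁ᵀ‖_F² + ((1−2β)³/2)‖B₁ᵀB₂ − B₂ᵀB₁‖_F² + β²‖B₁A₂ − B₂A₁‖_F² + (β/4)‖A₁A₂ − A₂A₁ − (3−4β)(B₁ᵀB₂ − B₂ᵀB₁)‖_F², in which the first term vanishes since B₁B₂ᵀ − B₂B₁ᵀ is a skew-symmetric 1×1 matrix, satisfies 𝒦_β(Δ₁,Δ₂) ≤ 1/(2β). (This is the statement that the sectional curvature of St_β(n,n−1), with p = n−1, is bounded above by 1/(2β) for β ∈ (1/3,2/3).) -/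

import Mathlib

open Matrix

/-- The squared Frobenius norm of a real matrix. -/
noncomputable def frobSq {m n : Type*} [Fintype m] [Fintype n] (A : Matrix m n ℝ) : ℝ :=
  ∑ i, ∑ j, (A i j) ^ 2

section Frobenius

variable {m n : Type*} [Fintype m] [Fintype n]

theorem frobSq_nonneg (X : Matrix m n ℝ) : 0 ≤ frobSq X :=
  Finset.sum_nonneg fun _ _ => Finset.sum_nonneg fun _ _ => sq_nonneg _

theorem frobSq_transpose (X : Matrix m n ℝ) : frobSq Xᵀ = frobSq X :=
  Finset.sum_comm

theorem frobSq_smul (c : ℝ) (X : Matrix m n ℝ) : frobSq (c • X) = c ^ 2 * frobSq X := by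
  simp [frobSq, Finset.mul_sum, mul_pow]

theorem frobSq_sub_le (X Y : Matrix m n ℝ) :
    frobSq (X - Y) ≤ 2 * frobSq X + 2 * frobSq Y := by
  simp only [frobSq, Finset.mul_sum, ← Finset.sum_add_distrib]
  refine Finset.sum_le_sum fun i _ => Finset.sum_le_sum fun j _ => ?_
  simp only [Matrix.sub_apply]
  nlinarith [sq_nonneg (X i j + Y i j)]

theorem frobSq_eq_sum_col (X : Matrix m n ℝ) : frobSq X = ∑ j, X.col j ⬝ᵥ X.col j := by
  rw [frobSq, Finset.sum_comm]
  simp [dotProduct, sq]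

theorem frobSq_mul_eq_sum_col (A : Matrix m n ℝ) {k : Type*} [Fintype k] (B : Matrix n k ℝ) :
    frobSq (A * B) = ∑ j, (A *ᵥ B.col j) ⬝ᵥ (A *ᵥ B.col j) := by
  rw [frobSq_eq_sum_col]
  rfl

theorem frobSq_mul_le {A : Matrix m n ℝ} {c : ℝ}
    (hA : ∀ x, (A *ᵥ x) ⬝ᵥ (A *ᵥ x) ≤ c * (x ⬝ᵥ x)) {k : Type*} [Fintype k]
    (B : Matrix n k ℝ) : frobSq (A * B) ≤ c * frobSq B := by
  rw [frobSq_mul_eq_sum_col, frobSq_eq_sum_col B, Finset.mul_sum]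
  exact Finset.sum_le_sum fun j _ => hA _

theorem dotProduct_self_nonneg' (x : n → ℝ) : 0 ≤ x ⬝ᵥ x :=
  Finset.sum_nonneg fun i _ => mul_self_nonneg (x i)

/-- Subtracting the wedge `p qᵀ - q pᵀ` of two vectors from a matrix. -/
theorem frobSq_sub_wedge (X : Matrix n n ℝ) (p q : n → ℝ) :
    frobSq (X - (vecMulVec p q - vecMulVec q p)) =
      frobSq X - 2 * (p ⬝ᵥ X *ᵥ q - q ⬝ᵥ X *ᵥ p) +
        2 * ((p ⬝ᵥ p) * (q ⬝ᵥ q) - (p ⬝ᵥ q) ^ 2) := by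
  have hpq : (p ⬝ᵥ p) * (q ⬝ᵥ q) = ∑ i, ∑ j, (p i) ^ 2 * (q j) ^ 2 := by
    simp only [dotProduct, Finset.sum_mul_sum, sq]
  have hqp : (p ⬝ᵥ p) * (q ⬝ᵥ q) = ∑ i, ∑ j, (q i) ^ 2 * (p j) ^ 2 := by
    rw [hpq, Finset.sum_comm]
    simp only [mul_comm]
  have hc : (p ⬝ᵥ q) ^ 2 = ∑ i, ∑ j, p i * q i * (p j * q j) := by
    simp only [dotProduct, Finset.sum_mul_sum, sq]
  have h1 : p ⬝ᵥ X *ᵥ q = ∑ i, ∑ j, p i * (X i j * q j) := by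
    simp only [dotProduct, mulVec, Finset.mul_sum]
  have h2 : q ⬝ᵥ X *ᵥ p = ∑ i, ∑ j, q i * (X i j * p j) := by
    simp only [dotProduct, mulVec, Finset.mul_sum]
  have h : 2 * ((p ⬝ᵥ p) * (q ⬝ᵥ q) - (p ⬝ᵥ q) ^ 2) =
      (p ⬝ᵥ p) * (q ⬝ᵥ q) + (p ⬝ᵥ p) * (q ⬝ᵥ q) - 2 * (p ⬝ᵥ q) ^ 2 := by ring
  rw [h]
  nth_rw 1 [hpq]
  rw [hqp, hc, h1, h2]
  simp only [frobSq, Finset.mul_sum, ← Finset.sum_sub_distrib, ← Finset.sum_add_distrib]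
  refine Finset.sum_congr rfl fun i _ => Finset.sum_congr rfl fun j _ => ?_
  simp only [Matrix.sub_apply, vecMulVec_apply]
  ring

theorem frobSq_wedge (p q : n → ℝ) :
    frobSq (vecMulVec p q - vecMulVec q p) =
      2 * ((p ⬝ᵥ p) * (q ⬝ᵥ q) - (p ⬝ᵥ q) ^ 2) := by
  have h := frobSq_sub_wedge (0 : Matrix n n ℝ) q p
  have h0 : frobSq (0 : Matrix n n ℝ) = 0 := by simp [frobSq]
  rw [zero_sub, neg_sub, h0, dotProduct_comm q p] at h
  simpa [mul_comm (q ⬝ᵥ q)] using h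

theorem wedge_mulVec (p q x : n → ℝ) :
    (vecMulVec p q - vecMulVec q p) *ᵥ x = (q ⬝ᵥ x) • p - (p ⬝ᵥ x) • q := by
  rw [sub_mulVec, vecMulVec_mulVec, vecMulVec_mulVec]
  simp

end Frobenius

section Skew

variable {n : Type*} [Fintype n] {A B : Matrix n n ℝ}

theorem dotProduct_mulVec_of_skew (hA : Aᵀ = -A) (x y : n → ℝ) :
    x ⬝ᵥ A *ᵥ y = -(y ⬝ᵥ A *ᵥ x) := by
  rw [dotProduct_mulVec, ← mulVec_transpose, hA, neg_mulVec, neg_dotProduct, dotProduct_comm]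

theorem dotProduct_mulVec_self_of_skew (hA : Aᵀ = -A) (x : n → ℝ) : x ⬝ᵥ A *ᵥ x = 0 := by
  linarith [dotProduct_mulVec_of_skew hA x x]

/-- The operator norm of a skew-symmetric matrix satisfies `2 ‖A‖² ≤ ‖A‖_F²`. -/
theorem two_mul_mulVec_sq_le_of_skew (hA : Aᵀ = -A) (x : n → ℝ) :
    2 * ((A *ᵥ x) ⬝ᵥ (A *ᵥ x)) ≤ frobSq A * (x ⬝ᵥ x) := by
  rcases (dotProduct_self_nonneg' x).eq_or_lt with hx | hx
  · have : x = 0 := dotProduct_self_eq_zero.1 hx.symm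
    simp [this]
  · have h := frobSq_nonneg (A - (vecMulVec ((x ⬝ᵥ x)⁻¹ • A *ᵥ x) x -
      vecMulVec x ((x ⬝ᵥ x)⁻¹ • A *ᵥ x)))
    have h1 := dotProduct_mulVec_of_skew hA x (A *ᵥ x)
    have h2 := dotProduct_mulVec_self_of_skew hA x
    rw [frobSq_sub_wedge] at h
    simp only [smul_dotProduct, dotProduct_smul, mulVec_smul, smul_eq_mul, h1,
      dotProduct_comm (A *ᵥ x) x, h2] at h
    field_simp at h
    nlinarith

theorem frobSq_commutator_le_four_mul (hA : Aᵀ = -A) (hB : Bᵀ = -B) :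
    frobSq (A * B - B * A) ≤ 4 * frobSq (A * B) := by
  have h : B * A = (A * B)ᵀ := by rw [transpose_mul, hA, hB, neg_mul_neg]
  have := frobSq_sub_le (A * B) (B * A)
  rw [h, frobSq_transpose] at *
  linarith

variable {u v : n → ℝ} {r : ℝ}

theorem mulVec_sq_le_of_invariant_plane (hA : Aᵀ = -A) (hu : u ⬝ᵥ u = 1) (hv : v ⬝ᵥ v = 1)
    (huv : u ⬝ᵥ v = 0) (hAu : A *ᵥ u = r • v) (hAv : A *ᵥ v = -(r • u)) (x : n → ℝ) :
    (A *ᵥ x) ⬝ᵥ (A *ᵥ x) ≤ (frobSq A / 2 - r ^ 2) * (x ⬝ᵥ x) +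
      (2 * r ^ 2 - frobSq A / 2) * ((u ⬝ᵥ x) ^ 2 + (v ⬝ᵥ x) ^ 2) := by
  have hvu : v ⬝ᵥ u = 0 := by rw [dotProduct_comm, huv]
  set w := x - (u ⬝ᵥ x) • u - (v ⬝ᵥ x) • v with hw
  have huw : u ⬝ᵥ w = 0 := by simp [hw, dotProduct_sub, hu, huv]
  have hvw : v ⬝ᵥ w = 0 := by simp [hw, dotProduct_sub, hv, hvu]
  have hwu : w ⬝ᵥ u = 0 := by rw [dotProduct_comm, huw]
  have hwv : w ⬝ᵥ v = 0 := by rw [dotProduct_comm, hvw]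
  have hx : x = w + (u ⬝ᵥ x) • u + (v ⬝ᵥ x) • v := by rw [hw]; abel
  have huAw : u ⬝ᵥ A *ᵥ w = 0 := by
    rw [dotProduct_mulVec_of_skew hA, hAu, dotProduct_smul, hwv]; simp
  have hvAw : v ⬝ᵥ A *ᵥ w = 0 := by
    rw [dotProduct_mulVec_of_skew hA, hAv, dotProduct_neg, dotProduct_smul, hwu]; simp
  set s := u ⬝ᵥ x
  set t := v ⬝ᵥ x
  have hxx : x ⬝ᵥ x = w ⬝ᵥ w + s ^ 2 + t ^ 2 := by
    rw [hx]
    simp only [add_dotProduct, dotProduct_add, smul_dotProduct, dotProduct_smul, smul_eq_mul,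
      hu, hv, huv, hvu, huw, hvw, hwu, hwv]
    ring
  have hAx : (A *ᵥ x) ⬝ᵥ (A *ᵥ x) = (A *ᵥ w) ⬝ᵥ (A *ᵥ w) + r ^ 2 * (s ^ 2 + t ^ 2) := by
    rw [hx]
    simp only [mulVec_add, mulVec_smul, hAu, hAv, add_dotProduct, dotProduct_add, smul_dotProduct,
      dotProduct_smul, smul_eq_mul, neg_dotProduct, dotProduct_neg, hu, hv, huv, hvu,
      dotProduct_comm (A *ᵥ w) u, dotProduct_comm (A *ᵥ w) v, huAw, hvAw]
    ring
  set A' := A - (vecMulVec (r • v) u - vecMulVec u (r • v)) with hA'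
  have hA's : A'ᵀ = -A' := by
    rw [hA', transpose_sub, transpose_sub, transpose_vecMulVec, transpose_vecMulVec, hA]; abel
  have hA'w : A' *ᵥ w = A *ᵥ w := by
    rw [hA', sub_mulVec, wedge_mulVec]
    simp [huw, hvw]
  have hn : frobSq A' = frobSq A - 2 * r ^ 2 := by
    rw [hA', frobSq_sub_wedge]
    simp only [mulVec_smul, hAu, hAv, smul_dotProduct, dotProduct_smul, smul_eq_mul, hu, hv, hvu,
      dotProduct_neg]
    ring
  have h := two_mul_mulVec_sq_le_of_skew hA's w
  rw [hA'w, hn] at h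
  rw [hAx, hxx]
  linarith

theorem two_mul_sq_add_sq_le_frobSq (hB : Bᵀ = -B) (hu : u ⬝ᵥ u = 1) (hv : v ⬝ᵥ v = 1)
    (huv : u ⬝ᵥ v = 0) (h0 : u ⬝ᵥ B *ᵥ v = 0) :
    2 * ((B *ᵥ u) ⬝ᵥ (B *ᵥ u) + (B *ᵥ v) ⬝ᵥ (B *ᵥ v)) ≤ frobSq B := by
  have hvu : v ⬝ᵥ u = 0 := by rw [dotProduct_comm, huv]
  have h0' : v ⬝ᵥ B *ᵥ u = 0 := by rw [dotProduct_mulVec_of_skew hB, h0, neg_zero]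
  have huu := dotProduct_mulVec_self_of_skew hB u
  have hvv := dotProduct_mulVec_self_of_skew hB v
  have hu2 := dotProduct_mulVec_of_skew hB u (B *ᵥ u)
  have hv2 := dotProduct_mulVec_of_skew hB v (B *ᵥ v)
  have h := frobSq_nonneg (B - (vecMulVec (B *ᵥ u) u - vecMulVec u (B *ᵥ u)) -
    (vecMulVec (B *ᵥ v) v - vecMulVec v (B *ᵥ v)))
  rw [frobSq_sub_wedge, frobSq_sub_wedge] at h
  simp only [sub_mulVec B, wedge_mulVec, dotProduct_sub,
    dotProduct_smul, smul_eq_mul, dotProduct_comm (B *ᵥ u) u, dotProduct_comm (B *ᵥ v) v,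
    dotProduct_comm (B *ᵥ u) v, dotProduct_comm (B *ᵥ v) u, hu, hv, huv, hvu, huu, hvv, h0, h0',
    hu2, hv2] at h
  linarith

theorem frobSq_mul_le_of_invariant_plane (hA : Aᵀ = -A) (hB : Bᵀ = -B) (hu : u ⬝ᵥ u = 1)
    (hv : v ⬝ᵥ v = 1) (huv : u ⬝ᵥ v = 0) (hAu : A *ᵥ u = r • v) (hAv : A *ᵥ v = -(r • u))
    (hr : frobSq A ≤ 4 * r ^ 2) (h0 : u ⬝ᵥ B *ᵥ v = 0) :
    4 * frobSq (A * B) ≤ frobSq A * frobSq B := by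
  have key (y : n → ℝ) : ∑ j, (y ⬝ᵥ B.col j) ^ 2 = (B *ᵥ y) ⬝ᵥ (B *ᵥ y) := by
    have : B *ᵥ y = -(y ᵥ* B) := by rw [← mulVec_transpose, hB, neg_mulVec, neg_neg]
    rw [this, neg_dotProduct_neg]
    simp [dotProduct, vecMul, sq]
  have h1 : frobSq (A * B) ≤ (frobSq A / 2 - r ^ 2) * frobSq B +
      (2 * r ^ 2 - frobSq A / 2) * ((B *ᵥ u) ⬝ᵥ (B *ᵥ u) + (B *ᵥ v) ⬝ᵥ (B *ᵥ v)) := by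
    rw [frobSq_mul_eq_sum_col, frobSq_eq_sum_col B, ← key, ← key, ← Finset.sum_add_distrib,
      Finset.mul_sum, Finset.mul_sum, ← Finset.sum_add_distrib]
    exact Finset.sum_le_sum fun j _ => mulVec_sq_le_of_invariant_plane hA hu hv huv hAu hAv _
  have h2 := two_mul_sq_add_sq_le_frobSq hB hu hv huv h0
  nlinarith [mul_le_mul_of_nonneg_left h2 (by linarith : 0 ≤ 4 * r ^ 2 - frobSq A)]

theorem frobSq_commutator_le_of_invariant_plane (hA : Aᵀ = -A) (hB : Bᵀ = -B)
    (hu : u ⬝ᵥ u = 1) (hv : v ⬝ᵥ v = 1) (huv : u ⬝ᵥ v = 0) (hAu : A *ᵥ u = r • v)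
    (hAv : A *ᵥ v = -(r • u)) (hr : frobSq A ≤ 4 * r ^ 2) :
    frobSq (A * B - B * A) ≤ frobSq A * frobSq B := by
  have hvu : v ⬝ᵥ u = 0 := by rw [dotProduct_comm, huv]
  set t := u ⬝ᵥ B *ᵥ v with ht
  have ht' : v ⬝ᵥ B *ᵥ u = -t := by rw [dotProduct_mulVec_of_skew hB]
  set B' := B - (vecMulVec (t • u) v - vecMulVec v (t • u)) with hB'
  have hB's : B'ᵀ = -B' := by
    rw [hB', transpose_sub, transpose_sub, transpose_vecMulVec, transpose_vecMulVec, hB]; abel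
  have hn : frobSq B' ≤ frobSq B := by
    rw [hB', frobSq_sub_wedge]
    simp only [mulVec_smul, smul_dotProduct, dotProduct_smul, smul_eq_mul, hu, hv, huv, ht', ← ht]
    nlinarith [sq_nonneg t]
  have h0 : u ⬝ᵥ B' *ᵥ v = 0 := by
    rw [hB', sub_mulVec, wedge_mulVec]
    simp [dotProduct_sub, hu, hv, huv, ← ht]
  have huA : u ᵥ* A = -(r • v) := by rw [← mulVec_transpose, hA, neg_mulVec, hAu]
  have hvA : v ᵥ* A = r • u := by rw [← mulVec_transpose, hA, neg_mulVec, hAv, neg_neg]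
  have hc : A * B - B * A = A * B' - B' * A := by
    have : A * (vecMulVec (t • u) v - vecMulVec v (t • u)) =
        (vecMulVec (t • u) v - vecMulVec v (t • u)) * A := by
      rw [mul_sub, sub_mul, mul_vecMulVec, mul_vecMulVec, vecMulVec_mul, vecMulVec_mul,
        mulVec_smul, smul_vecMul, hAu, hAv, huA, hvA]
      ext i j
      simp [vecMulVec_apply]
      ring
    rw [hB', mul_sub A, sub_mul _ _ A, this]
    abel
  rw [hc]
  exact (frobSq_commutator_le_four_mul hA hB's).trans
    ((frobSq_mul_le_of_invariant_plane hA hB's hu hv huv hAu hAv hr h0).trans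
      (mul_le_mul_of_nonneg_left hn (frobSq_nonneg A)))

/-- The commutator of skew-symmetric matrices satisfies `‖[A, B]‖_F ≤ ‖A‖_F ‖B‖_F`. -/
theorem frobSq_commutator_le_of_skew [DecidableEq n] (hA : Aᵀ = -A) (hB : Bᵀ = -B) :
    frobSq (A * B - B * A) ≤ frobSq A * frobSq B := by
  set N : Matrix n n ℝ := (frobSq A / 4) • 1 - Aᵀ * A with hN
  have hNH : N.IsHermitian := by
    rw [IsHermitian, conjTranspose_eq_transpose_of_trivial, hN]
    simp [transpose_sub, transpose_mul]
  have hquad (x : n → ℝ) : x ⬝ᵥ N *ᵥ x =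
      frobSq A / 4 * (x ⬝ᵥ x) - (A *ᵥ x) ⬝ᵥ (A *ᵥ x) := by
    rw [hN, sub_mulVec, smul_mulVec, one_mulVec, dotProduct_sub, dotProduct_smul, smul_eq_mul,
      ← mulVec_mulVec, dotProduct_mulVec x Aᵀ, vecMul_transpose]
  by_cases hps : N.PosSemidef
  · have h (x : n → ℝ) : (A *ᵥ x) ⬝ᵥ (A *ᵥ x) ≤ frobSq A / 4 * (x ⬝ᵥ x) := by
      have := hps.dotProduct_mulVec_nonneg x
      rw [star_trivial, hquad] at this
      linarith
    linarith [frobSq_commutator_le_four_mul hA hB, frobSq_mul_le h B]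
  · rw [hNH.posSemidef_iff_eigenvalues_nonneg, Pi.le_def] at hps
    push Not at hps
    obtain ⟨i, hi⟩ := hps
    set μ := hNH.eigenvalues i
    obtain ⟨u, hu, hNu⟩ : ∃ u : n → ℝ, u ⬝ᵥ u = 1 ∧ N *ᵥ u = μ • u := by
      refine ⟨⇑(hNH.eigenvectorBasis i), ?_, hNH.mulVec_eigenvectorBasis i⟩
      have := hNH.eigenvectorBasis.orthonormal.1 i
      rw [EuclideanSpace.norm_eq, Real.sqrt_eq_one] at this
      simpa [dotProduct, sq] using this
    set d := frobSq A / 4 - μ with hd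
    have hAA : A *ᵥ (A *ᵥ u) = -(d • u) := by
      have : N *ᵥ u = (frobSq A / 4) • u + A *ᵥ (A *ᵥ u) := by
        rw [hN, hA, sub_mulVec, smul_mulVec, one_mulVec, neg_mul, neg_mulVec, mulVec_mulVec,
          sub_neg_eq_add]
      rw [hNu] at this
      rw [hd, sub_smul, this]
      abel
    have hi' : μ < 0 := hi
    have ha := frobSq_nonneg A
    have hdpos : 0 < d := by linarith
    have hr : √d ^ 2 = d := Real.sq_sqrt hdpos.le
    have hr0 : √d ≠ 0 := (Real.sqrt_pos.2 hdpos).ne'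
    have hAuAu : (A *ᵥ u) ⬝ᵥ (A *ᵥ u) = d := by
      have := dotProduct_mulVec_of_skew hA (A *ᵥ u) u
      rw [this, hAA, dotProduct_neg, dotProduct_smul, hu]
      simp
    refine frobSq_commutator_le_of_invariant_plane (u := u) (v := (√d)⁻¹ • A *ᵥ u) (r := √d)
      hA hB hu ?_ ?_ ?_ ?_ ?_
    · rw [smul_dotProduct, dotProduct_smul, hAuAu, smul_eq_mul, smul_eq_mul]
      field_simp
      exact hr.symm
    · rw [dotProduct_smul, dotProduct_mulVec_self_of_skew hA, smul_zero]
    · rw [smul_smul, mul_inv_cancel₀ hr0, one_smul]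
    · rw [mulVec_smul, hAA, smul_neg, smul_smul]
      congr 2
      field_simp
      exact hr.symm
    · rw [hr, hd]
      linarith

end Skew

/-- A multilinear inequality on the unit square, checked at the corners. -/
theorem bilinear_le_one {u v k e : ℝ} (hu : 0 ≤ u) (hu' : u ≤ 1) (hv : 0 ≤ v) (hv' : v ≤ 1)
    (hk : k ≤ 1) (he : e ≤ 1) :
    e * ((1 - u) * (1 - v)) + k * (u * (1 - v) + v * (1 - u)) + u * v ≤ 1 := by
  have h1 := mul_nonneg (sub_nonneg.2 hu') (sub_nonneg.2 hv')
  have h2 := mul_nonneg hu (sub_nonneg.2 hv')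
  have h3 := mul_nonneg hv (sub_nonneg.2 hu')
  nlinarith


/-- Upper bound for the sectional curvature of `St_β(n,n−1)` for `β ∈ (1/3, 2/3)`: with `q = 1`
(so `B₁, B₂` are row vectors), for every β-orthonormal pair of tangent vectors
`Δᵢ = (Aᵢ, Bᵢ)`, the sectional curvature `𝒦_β(Δ₁,Δ₂)` (Nguyen's formula) satisfies
`𝒦_β(Δ₁,Δ₂) ≤ 1/(2β)`. -/
theorem sectional_curvature_upper_bound_p_eq_n_sub_one
    (β : ℝ) (hβl : 1 / 3 < β) (hβu : β < 2 / 3)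
    (p : ℕ) (hp : 0 < p)
    (A₁ A₂ : Matrix (Fin p) (Fin p) ℝ) (B₁ B₂ : Matrix (Fin 1) (Fin p) ℝ)
    (hA₁ : A₁ᵀ = -A₁) (hA₂ : A₂ᵀ = -A₂)
    (hn₁ : β * frobSq A₁ + frobSq B₁ = 1) (hn₂ : β * frobSq A₂ + frobSq B₂ = 1)
    (horth : β * Matrix.trace (A₁ᵀ * A₂) + Matrix.trace (B₁ᵀ * B₂) = 0) :
    (1 / 2) * frobSq (B₁ * B₂ᵀ - B₂ * B₁ᵀ) +
        ((1 - 2 * β) ^ 3 / 2) * frobSq (B₁ᵀ * B₂ - B₂ᵀ * B₁) +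
        β ^ 2 * frobSq (B₁ * A₂ - B₂ * A₁) +
        (β / 4) * frobSq (A₁ * A₂ - A₂ * A₁ - (3 - 4 * β) • (B₁ᵀ * B₂ - B₂ᵀ * B₁)) ≤
      1 / (2 * β) := by
  set b₁ : Fin p → ℝ := B₁ 0 with hb₁
  set b₂ : Fin p → ℝ := B₂ 0 with hb₂
  have hs₁ : frobSq B₁ = b₁ ⬝ᵥ b₁ := by simp [frobSq, dotProduct, sq, hb₁]
  have hs₂ : frobSq B₂ = b₂ ⬝ᵥ b₂ := by simp [frobSq, dotProduct, sq, hb₂]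
  have hT₁ : frobSq (B₁ * B₂ᵀ - B₂ * B₁ᵀ) = 0 := by
    simp [frobSq, mul_apply, mul_comm]
  have hW : frobSq (B₁ᵀ * B₂ - B₂ᵀ * B₁) =
      2 * (frobSq B₁ * frobSq B₂ - (b₁ ⬝ᵥ b₂) ^ 2) := by
    rw [hs₁, hs₂, ← frobSq_wedge]
    congr 1
    ext i j
    simp [mul_apply, vecMulVec_apply, hb₁, hb₂]
  have hBA (B : Matrix (Fin 1) (Fin p) ℝ) {A : Matrix (Fin p) (Fin p) ℝ} (hA : Aᵀ = -A) :
      2 * frobSq (B * A) ≤ frobSq A * frobSq B := by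
    have h : frobSq (B * A) = frobSq (A * Bᵀ) := by
      rw [← frobSq_transpose, transpose_mul, hA, Matrix.neg_mul, ← neg_one_smul ℝ, frobSq_smul]
      ring
    have h' := frobSq_mul_le (A := A) (c := frobSq A / 2)
      (fun x => by linarith [two_mul_mulVec_sq_le_of_skew hA x]) Bᵀ
    rw [h]
    rw [frobSq_transpose] at h'
    linarith
  have hM := frobSq_sub_le (B₁ * A₂) (B₂ * A₁)
  have hM₁ := hBA B₁ hA₂
  have hM₂ := hBA B₂ hA₁
  have hL := frobSq_sub_le (A₁ * A₂ - A₂ * A₁) ((3 - 4 * β) • (B₁ᵀ * B₂ - B₂ᵀ * B₁))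
  rw [frobSq_smul] at hL
  have hC := frobSq_commutator_le_of_skew hA₁ hA₂
  have hW0 := frobSq_nonneg (B₁ᵀ * B₂ - B₂ᵀ * B₁)
  have hW1 : frobSq (B₁ᵀ * B₂ - B₂ᵀ * B₁) ≤ 2 * (frobSq B₁ * frobSq B₂) := by
    rw [hW]; nlinarith [sq_nonneg (b₁ ⬝ᵥ b₂)]
  have hA₁0 := frobSq_nonneg A₁
  have hA₂0 := frobSq_nonneg A₂
  have hB₁0 := frobSq_nonneg B₁
  have hB₂0 := frobSq_nonneg B₂
  have hβ : 0 < β := by linarith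
  rw [hT₁]
  generalize frobSq (B₁ᵀ * B₂ - B₂ᵀ * B₁) = W at *
  generalize frobSq (B₁ * A₂ - B₂ * A₁) = M at *
  generalize frobSq (A₁ * A₂ - A₂ * A₁ - (3 - 4 * β) • (B₁ᵀ * B₂ - B₂ᵀ * B₁)) = L at *
  generalize frobSq (A₁ * A₂ - A₂ * A₁) = C at *
  generalize frobSq A₁ = a₁ at *
  generalize frobSq A₂ = a₂ at *
  generalize frobSq (B₁ * A₂) = m₁ at *
  generalize frobSq (B₂ * A₁) = m₂ at *
  clear hBA hs₁ hs₂ hW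
  generalize frobSq B₁ = s₁ at *
  generalize frobSq B₂ = s₂ at *
  obtain rfl : s₁ = 1 - β * a₁ := by linarith
  obtain rfl : s₂ = 1 - β * a₂ := by linarith
  have hM' : M ≤ a₂ * (1 - β * a₁) + a₁ * (1 - β * a₂) := by linarith
  have hL' : L ≤ 2 * (a₁ * a₂) + 2 * ((3 - 4 * β) ^ 2 * W) := by linarith
  have hcube : (1 - 2 * β) ^ 3 ≤ 1 / 27 := by
    have : (1 - 2 * β) ^ 3 ≤ (1 / 3) ^ 3 :=
      (show Odd 3 by decide).pow_le_pow.2 (by linarith)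
    linarith
  have hq : (β * (3 - 4 * β)) ^ 2 ≤ (9 / 16) ^ 2 :=
    pow_le_pow_left₀ (mul_nonneg hβ.le (by linarith)) (by nlinarith [sq_nonneg (β - 3 / 8)]) 2
  have hmain := bilinear_le_one (u := β * a₁) (v := β * a₂) (k := 2 * β ^ 2)
    (e := 2 * β / 27 + 2 * (9 / 16) ^ 2) (by positivity) (by linarith) (by positivity)
    (by linarith) (by nlinarith) (by linarith)
  rw [le_div_iff₀ (by positivity)]
  have e1 : (1 - 2 * β) ^ 3 * (β * W) ≤ 1 / 27 * (β * W) :=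
    mul_le_mul_of_nonneg_right hcube (by positivity)
  have e2 : (β * (3 - 4 * β)) ^ 2 * W ≤ (9 / 16) ^ 2 * W :=
    mul_le_mul_of_nonneg_right hq hW0
  have e3 := mul_le_mul_of_nonneg_left hM' (by positivity : 0 ≤ 2 * β ^ 3)
  have e4 := mul_le_mul_of_nonneg_left hL' (by positivity : 0 ≤ β ^ 2 / 2)
  have e5 := mul_le_mul_of_nonneg_left hW1 (by positivity : 0 ≤ β / 27 + (9 / 16) ^ 2)
  linarith
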